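/- For each ε > 0, the circuit sum at a = 1 has the expansion ∑_{n=1}^∞ S(nℓ) = 2/ℓ + log(ℓ/(4π)) + 1 + O(ℓ^{1−ε}) as ℓ → 0⁺, where S(t) = cosh(t)·log((cosh t + 1)/(cosh t − 1)) − 2. -/

import Mathlib

/-- `S(t) = cosh(t)·log((cosh t + 1)/(cosh t − 1)) − 2`. -/
noncomputable def Sfun (t : ℝ) : ℝ :=
  Real.cosh t * Real.log ((Real.cosh t + 1) / (Real.cosh t - 1)) - 2

open Real Filter Topology Set

/-- The antiderivative `sinh(t)·log((cosh t + 1)/(cosh t − 1))` of `Sfun` on the positive axis. -/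
noncomputable def SfunPrimitive (t : ℝ) : ℝ :=
  sinh t * log ((cosh t + 1) / (cosh t - 1))

lemma sinh_le_self_mul_cosh {t : ℝ} (ht : 0 ≤ t) : sinh t ≤ t * cosh t := by
  have hmono : MonotoneOn (fun t : ℝ => t * cosh t - sinh t) (Ici 0) := by
    refine monotoneOn_of_hasDerivWithinAt_nonneg (convex_Ici 0) (f' := fun t => t * sinh t)
      (by fun_prop) (fun t _ => ?_) (fun t ht => ?_)
    · have h := ((hasDerivAt_id t).mul (hasDerivAt_cosh t)).sub (hasDerivAt_sinh t)
      refine (h.congr_deriv ?_).hasDerivWithinAt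
      simp
    · rw [interior_Ici, mem_Ioi] at ht
      exact mul_nonneg ht.le (sinh_nonneg_iff.2 ht.le)
  have h := hmono self_mem_Ici (mem_Ici.2 ht) ht
  simp only [zero_mul, sinh_zero, sub_zero] at h
  linarith

lemma hasDerivAt_log_cosh_ratio {t : ℝ} (ht : 0 < t) :
    HasDerivAt (fun t => log ((cosh t + 1) / (cosh t - 1))) (-2 / sinh t) t := by
  have hc : 1 < cosh t := one_lt_cosh.2 ht.ne'
  have hs : 0 < sinh t := sinh_pos_iff.2 ht
  have hsq := cosh_sq t
  have h1 : 0 < cosh t - 1 := by linarith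
  have h2 : 0 < cosh t + 1 := by linarith
  have h := (((hasDerivAt_cosh t).add_const 1).div ((hasDerivAt_cosh t).sub_const 1) h1.ne').log
    (div_pos h2 h1).ne'
  refine h.congr_deriv ?_
  simp only [Pi.div_apply]
  field_simp
  linear_combination 2 * hsq

lemma hasDerivAt_SfunPrimitive {t : ℝ} (ht : 0 < t) :
    HasDerivAt SfunPrimitive (Sfun t) t := by
  have hs : 0 < sinh t := sinh_pos_iff.2 ht
  refine ((hasDerivAt_sinh t).mul (hasDerivAt_log_cosh_ratio ht)).congr_deriv ?_
  rw [Sfun]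
  field_simp
  ring

lemma hasDerivAt_Sfun {t : ℝ} (ht : 0 < t) :
    HasDerivAt Sfun (SfunPrimitive t - 2 * cosh t / sinh t) t := by
  have h := ((hasDerivAt_cosh t).mul (hasDerivAt_log_cosh_ratio ht)).sub_const 2
  refine h.congr_deriv ?_
  rw [SfunPrimitive]
  ring

lemma two_div_cosh_le_log_cosh_ratio {t : ℝ} (ht : 0 < t) :
    2 / cosh t ≤ log ((cosh t + 1) / (cosh t - 1)) := by
  have hc : 1 < cosh t := one_lt_cosh.2 ht.ne'
  have h1 : 0 < cosh t - 1 := by linarith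
  have h := le_log_one_add_of_nonneg (x := 2 / (cosh t - 1)) (by positivity)
  convert h using 1
  · field_simp
    ring
  · congr 1
    field_simp
    ring

lemma log_cosh_ratio_le {t : ℝ} (ht : 0 < t) :
    log ((cosh t + 1) / (cosh t - 1)) ≤ 2 / (cosh t - 1) := by
  have hc : 1 < cosh t := one_lt_cosh.2 ht.ne'
  have h1 : 0 < cosh t - 1 := by linarith
  have h := log_le_sub_one_of_pos (x := (cosh t + 1) / (cosh t - 1)) (by positivity)
  convert h using 1
  field_simp
  ring

lemma Sfun_nonneg {t : ℝ} (ht : 0 < t) : 0 ≤ Sfun t := by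
  have h := mul_le_mul_of_nonneg_left (two_div_cosh_le_log_cosh_ratio ht) (cosh_pos t).le
  rw [mul_div_cancel₀ _ (cosh_pos t).ne'] at h
  rw [Sfun]
  linarith

lemma SfunPrimitive_nonneg {t : ℝ} (ht : 0 < t) : 0 ≤ SfunPrimitive t :=
  mul_nonneg (sinh_nonneg_iff.2 ht.le)
    (le_trans (by have := cosh_pos t; positivity) (two_div_cosh_le_log_cosh_ratio ht))

lemma monotoneOn_SfunPrimitive : MonotoneOn SfunPrimitive (Ioi 0) := by
  refine monotoneOn_of_hasDerivWithinAt_nonneg (convex_Ioi 0) (f' := Sfun)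
    (fun t ht => (hasDerivAt_SfunPrimitive ht).continuousAt.continuousWithinAt)
    (fun t ht => ?_) (fun t ht => ?_) <;> rw [interior_Ioi] at *
  · exact (hasDerivAt_SfunPrimitive ht).hasDerivWithinAt
  · exact Sfun_nonneg ht

lemma monotoneOn_coth_sub_inv :
    MonotoneOn (fun t : ℝ => 2 * cosh t / sinh t - 2 / t) (Ioi 0) := by
  have hd : ∀ t ∈ Ioi (0 : ℝ), HasDerivAt (fun t : ℝ => 2 * cosh t / sinh t - 2 / t)
      (2 / t ^ 2 - 2 / sinh t ^ 2) t := by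
    intro t ht
    rw [mem_Ioi] at ht
    have hs : 0 < sinh t := sinh_pos_iff.2 ht
    have h := (((hasDerivAt_cosh t).const_mul 2).div (hasDerivAt_sinh t) hs.ne').sub
      ((hasDerivAt_const t (2 : ℝ)).div (hasDerivAt_id t) ht.ne')
    refine h.congr_deriv ?_
    have hsq := cosh_sq t
    simp only [id]
    field_simp
    linear_combination (-2 * t ^ 2) * hsq
  refine monotoneOn_of_hasDerivWithinAt_nonneg (convex_Ioi 0)
    (f' := fun t => 2 / t ^ 2 - 2 / sinh t ^ 2)
    (fun t ht => (hd t ht).continuousAt.continuousWithinAt)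
    (fun t ht => ?_) (fun t ht => ?_) <;> rw [interior_Ioi] at *
  · exact (hd t ht).hasDerivWithinAt
  · rw [mem_Ioi] at ht
    have hs : t ≤ sinh t := self_le_sinh_iff.2 ht.le
    rw [sub_nonneg]
    gcongr

lemma coth_sub_inv_nonneg {t : ℝ} (ht : 0 < t) : 0 ≤ 2 * cosh t / sinh t - 2 / t := by
  have hs : 0 < sinh t := sinh_pos_iff.2 ht
  rw [sub_nonneg, div_le_div_iff₀ ht hs]
  linarith [sinh_le_self_mul_cosh ht.le]

lemma tendsto_cosh_atTop : Tendsto cosh atTop atTop := by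
  refine tendsto_atTop_mono (fun t => ?_) (tendsto_exp_atTop.atTop_div_const (zero_lt_two' ℝ))
  rw [cosh_eq]
  have := exp_pos (-t)
  linarith

lemma tendsto_tanh_atTop_one : Tendsto (fun t : ℝ => sinh t / cosh t) atTop (𝓝 1) := by
  have h : Tendsto (fun t : ℝ => 1 - exp (-t) / cosh t) atTop (𝓝 (1 - 0)) :=
    tendsto_const_nhds.sub (tendsto_exp_neg_atTop_nhds_zero.div_atTop tendsto_cosh_atTop)
  rw [sub_zero] at h
  refine h.congr fun t => ?_
  have := cosh_pos t
  rw [← cosh_sub_sinh]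
  field_simp
  ring

lemma tendsto_coth_atTop_two : Tendsto (fun t : ℝ => 2 * cosh t / sinh t) atTop (𝓝 2) := by
  have h := (tendsto_tanh_atTop_one.inv₀ one_ne_zero).const_mul 2
  rw [inv_one, mul_one] at h
  refine h.congr fun t => ?_
  rw [inv_div, mul_div_assoc]

lemma tendsto_SfunPrimitive_atTop : Tendsto SfunPrimitive atTop (𝓝 2) := by
  have hlow : Tendsto (fun t : ℝ => 2 * (sinh t / cosh t)) atTop (𝓝 2) := by
    simpa using tendsto_tanh_atTop_one.const_mul 2
  have hupp : Tendsto (fun t : ℝ => 2 * (sinh t / cosh t) / (1 - 1 / cosh t)) atTop (𝓝 2) := by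
    have h : Tendsto (fun t : ℝ => 1 - 1 / cosh t) atTop (𝓝 (1 - 0)) :=
      tendsto_const_nhds.sub (tendsto_const_nhds.div_atTop tendsto_cosh_atTop)
    have h2 := hlow.div h (by norm_num)
    rwa [sub_zero, div_one] at h2
  refine tendsto_of_tendsto_of_tendsto_of_le_of_le' hlow hupp ?_ ?_ <;>
    filter_upwards [eventually_gt_atTop 0] with t ht
  · have := mul_le_mul_of_nonneg_left (two_div_cosh_le_log_cosh_ratio ht)
      (sinh_nonneg_iff.2 ht.le)
    rw [SfunPrimitive]
    convert this using 1
    ring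
  · have := mul_le_mul_of_nonneg_left (log_cosh_ratio_le ht) (sinh_nonneg_iff.2 ht.le)
    rw [SfunPrimitive]
    convert this using 1
    have hc : 1 < cosh t := one_lt_cosh.2 ht.ne'
    have h1 : cosh t - 1 ≠ 0 := by linarith
    field_simp

/-- Midpoint rule for a function whose derivative is a difference of monotone functions. -/
lemma abs_midpoint_error_le {h H P Q : ℝ → ℝ}
    (hH : ∀ t, 0 < t → HasDerivAt H (h t) t) (hh : ∀ t, 0 < t → HasDerivAt h (P t - Q t) t)
    (hP : MonotoneOn P (Ioi 0)) (hQ : MonotoneOn Q (Ioi 0)) {m r : ℝ} (hr : 0 < r) (hrm : r < m) :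
    |H (m + r) - H (m - r) - 2 * r * h m| ≤
      r ^ 2 * (P (m + r) - P (m - r) + (Q (m + r) - Q (m - r))) := by
  set V := P (m + r) - P (m - r) + (Q (m + r) - Q (m - r)) with hV
  have hdiff : ∀ a b : ℝ, m - r ≤ a → a ≤ m + r → m - r ≤ b → b ≤ m + r →
      |(P a - Q a) - (P b - Q b)| ≤ V := by
    intro a b ha ha' hb hb'
    have p1 := hP (mem_Ioi.2 (by linarith)) (mem_Ioi.2 (by linarith)) ha
    have p2 := hP (mem_Ioi.2 (by linarith)) (mem_Ioi.2 (by linarith)) ha'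
    have p3 := hP (mem_Ioi.2 (by linarith)) (mem_Ioi.2 (by linarith)) hb
    have p4 := hP (mem_Ioi.2 (by linarith)) (mem_Ioi.2 (by linarith)) hb'
    have q1 := hQ (mem_Ioi.2 (by linarith)) (mem_Ioi.2 (by linarith)) ha
    have q2 := hQ (mem_Ioi.2 (by linarith)) (mem_Ioi.2 (by linarith)) ha'
    have q3 := hQ (mem_Ioi.2 (by linarith)) (mem_Ioi.2 (by linarith)) hb
    have q4 := hQ (mem_Ioi.2 (by linarith)) (mem_Ioi.2 (by linarith)) hb'
    rw [abs_le]
    constructor <;> linarith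
  have hV0 : 0 ≤ V := le_trans (abs_nonneg _) (hdiff m m (by linarith) (by linarith)
    (by linarith) (by linarith))
  have hmvt : ∀ s ∈ Ioo 0 r, |h (m + s) + h (m - s) - 2 * h m| ≤ r * V := by
    intro s ⟨hs, hsr⟩
    obtain ⟨a, ha, hae⟩ := exists_hasDerivAt_eq_slope h (fun t => P t - Q t)
      (show m < m + s by linarith)
      (fun t ht => (hh t (by linarith [ht.1])).continuousAt.continuousWithinAt)
      (fun t ht => hh t (by linarith [ht.1]))
    obtain ⟨b, hb, hbe⟩ := exists_hasDerivAt_eq_slope h (fun t => P t - Q t)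
      (show m - s < m by linarith)
      (fun t ht => (hh t (by linarith [ht.1])).continuousAt.continuousWithinAt)
      (fun t ht => hh t (by linarith [ht.1]))
    have hab := hdiff a b (by linarith [ha.1]) (by linarith [ha.2]) (by linarith [hb.1])
      (by linarith [hb.2])
    have he : h (m + s) + h (m - s) - 2 * h m = s * ((P a - Q a) - (P b - Q b)) := by
      rw [hae, hbe]
      have : m + s - m ≠ 0 := by linarith
      have : m - (m - s) ≠ 0 := by linarith
      field_simp
      ring
    rw [he, abs_mul, abs_of_pos hs]
    exact mul_le_mul hsr.le hab (abs_nonneg _) hr.le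
  have hd : ∀ s, 0 ≤ s → s ≤ r →
      HasDerivAt (fun s => H (m + s) - H (m - s) - 2 * s * h m)
        (h (m + s) + h (m - s) - 2 * h m) s := by
    intro s hs hsr
    have h1 := (hH (m + s) (by linarith)).comp_const_add m s
    have h2 := (hH (m - s) (by linarith)).comp_const_sub m s
    have h3 := ((hasDerivAt_id s).const_mul 2).mul_const (h m)
    refine ((h1.sub h2).sub h3).congr_deriv ?_
    ring
  obtain ⟨s, hs, hse⟩ := exists_hasDerivAt_eq_slope _ _ hr
    (fun t ht => (hd t ht.1 ht.2).continuousAt.continuousWithinAt)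
    (fun t ht => hd t ht.1.le ht.2.le)
  have hfin : H (m + r) - H (m - r) - 2 * r * h m =
      r * (h (m + s) + h (m - s) - 2 * h m) := by
    rw [hse]
    simp only [add_zero, sub_zero, mul_zero, zero_mul, sub_self]
    field_simp
  rw [hfin, abs_mul, abs_of_pos hr, sq, mul_assoc]
  exact mul_le_mul_of_nonneg_left (hmvt s hs) hr.le

lemma abs_sum_midpoint_error_le {h H P Q : ℝ → ℝ}
    (hH : ∀ t, 0 < t → HasDerivAt H (h t) t) (hh : ∀ t, 0 < t → HasDerivAt h (P t - Q t) t)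
    (hP : MonotoneOn P (Ioi 0)) (hQ : MonotoneOn Q (Ioi 0)) {l : ℝ} (hl : 0 < l) (N : ℕ) :
    |H ((N + 1 / 2) * l) - H (l / 2) - l * ∑ n ∈ Finset.range N, h ((n + 1) * l)| ≤
      (l / 2) ^ 2 * (P ((N + 1 / 2) * l) - P (l / 2) + (Q ((N + 1 / 2) * l) - Q (l / 2))) := by
  induction N with
  | zero =>
    have h0 : ((0 : ℕ) + 1 / 2 : ℝ) * l = l / 2 := by push_cast; ring
    rw [h0]
    simp
  | succ N ih =>
    have hstep := abs_midpoint_error_le hH hh hP hQ (m := (N + 1) * l) (r := l / 2)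
      (by positivity) (by nlinarith [(Nat.cast_nonneg N : (0 : ℝ) ≤ N)])
    have e1 : ((N : ℝ) + 1) * l + l / 2 = ((N + 1 : ℕ) + 1 / 2) * l := by push_cast; ring
    have e2 : ((N : ℝ) + 1) * l - l / 2 = (N + 1 / 2) * l := by ring
    rw [e1, e2] at hstep
    rw [Finset.sum_range_succ]
    rw [abs_le] at *
    constructor <;> nlinarith [ih.1, ih.2, hstep.1, hstep.2]

lemma tendsto_stirling_half :
    Tendsto (fun N : ℕ => (2 * N + 1 : ℝ) * log (N + 1 / 2) - 2 * N - 2 * log (N.factorial))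
      atTop (𝓝 (1 - log (2 * π))) := by
  have hlog := ((continuousAt_log (by positivity : √π ≠ 0)).tendsto.comp
    Stirling.tendsto_stirlingSeq_sqrt_pi).const_mul 2
  have h2N : Tendsto (fun N : ℕ => (2 * N : ℝ)) atTop atTop :=
    tendsto_natCast_atTop_atTop.const_mul_atTop (by norm_num)
  have hA := (tendsto_mul_log_one_add_div_atTop 1).comp h2N
  have hB : Tendsto (fun N : ℕ => log (1 + 1 / (2 * N : ℝ))) atTop (𝓝 0) := by
    have h1 : Tendsto (fun N : ℕ => 1 + 1 / (2 * N : ℝ)) atTop (𝓝 (1 + 0)) :=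
      tendsto_const_nhds.add (tendsto_const_nhds.div_atTop h2N)
    rw [add_zero] at h1
    have h2 := (continuousAt_log one_ne_zero).tendsto.comp h1
    rwa [log_one] at h2
  have h := ((hA.add hB).sub hlog).sub_const (log 2)
  have hval : (1 : ℝ) + 0 - 2 * log √π - log 2 = 1 - log (2 * π) := by
    rw [log_sqrt pi_pos.le, log_mul two_ne_zero pi_ne_zero]
    ring
  rw [hval] at h
  refine h.congr' ?_
  filter_upwards [eventually_gt_atTop 0] with N hN
  have hN' : (0 : ℝ) < N := Nat.cast_pos.2 hN
  have e1 : log (N + 1 / 2) = log N + log (1 + 1 / (2 * N : ℝ)) := by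
    rw [← log_mul hN'.ne' (by positivity)]
    congr 1
    field_simp
  simp only [Function.comp_apply]
  rw [Stirling.log_stirlingSeq_formula, e1, log_div hN'.ne' (exp_pos 1).ne', log_exp,
    log_mul two_ne_zero hN'.ne']
  ring

lemma sum_log_succ_mul {l : ℝ} (hl : 0 < l) (N : ℕ) :
    ∑ n ∈ Finset.range N, log ((n + 1) * l) = log (N.factorial) + N * log l := by
  induction N with
  | zero => simp
  | succ N ih =>
    have hN : (N : ℝ) + 1 ≠ 0 := by positivity
    have hf : (N.factorial : ℝ) ≠ 0 := by exact_mod_cast N.factorial_ne_zero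
    rw [Finset.sum_range_succ, ih, Nat.factorial_succ]
    push_cast
    rw [log_mul hN hl.ne', log_mul hN hf]
    ring

lemma abs_SfunPrimitive_div_add_log_le {x : ℝ} (hx : 0 < x) (hx1 : x ≤ 1) :
    |SfunPrimitive x / (2 * x) + log (x / 2)| ≤ 3 * x := by
  have hs : 0 < sinh x := sinh_pos_iff.2 hx
  have hc : 1 < cosh x := one_lt_cosh.2 hx.ne'
  have hsq := cosh_sq x
  have hxs : x ≤ sinh x := self_le_sinh_iff.2 hx.le
  have hsx := sinh_le_self_mul_cosh hx.le
  have hlogc : log (cosh x) ≤ x ^ 2 / 2 := by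
    rw [log_le_iff_le_exp (by positivity)]
    exact cosh_le_exp_half_sq x
  have hc2 : cosh x ≤ 2 := by
    refine (cosh_le_exp_half_sq x).trans ?_
    rw [← le_log_iff_exp_le two_pos]
    nlinarith [log_two_gt_d9]
  set L := log ((cosh x + 1) / sinh x) with hL
  have hF : SfunPrimitive x / (2 * x) = sinh x / x * L := by
    have h1 : cosh x - 1 ≠ 0 := by linarith
    have : (cosh x + 1) / (cosh x - 1) = ((cosh x + 1) / sinh x) ^ 2 := by
      field_simp
      linear_combination (-1) * hsq
    rw [SfunPrimitive, this, log_pow, hL]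
    push_cast
    field_simp
  have hL0 : 0 ≤ L := by
    refine log_nonneg ?_
    rw [one_le_div hs]
    linarith [sinh_lt_cosh x]
  have hL1 : L ≤ (cosh x + 1) / sinh x :=
    (log_le_sub_one_of_pos (by positivity)).trans (by linarith)
  have hsum : L + log (x / 2) = log ((cosh x + 1) / sinh x * (x / 2)) := by
    rw [log_mul (by positivity) (by positivity)]
  have hup : L + log (x / 2) ≤ log (cosh x) := by
    rw [hsum]
    refine log_le_log (by positivity) ?_
    rw [div_mul_div_comm, div_le_iff₀ (by positivity)]
    nlinarith
  have hlo : -log (cosh x) ≤ L + log (x / 2) := by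
    rw [hsum, ← log_inv]
    refine log_le_log (by positivity) ?_
    rw [div_mul_div_comm, inv_eq_one_div, div_le_div_iff₀ (by positivity) (by positivity)]
    nlinarith
  have hr0 : 0 ≤ sinh x / x - 1 := by rw [sub_nonneg, one_le_div hx]; exact hxs
  have hr1 : sinh x / x - 1 ≤ cosh x - 1 := by
    rw [sub_le_sub_iff_right, div_le_iff₀ hx]
    linarith
  have hprod : (sinh x / x - 1) * L ≤ 2 * x := by
    calc (sinh x / x - 1) * L ≤ (cosh x - 1) * ((cosh x + 1) / sinh x) :=
          mul_le_mul hr1 hL1 hL0 (by linarith)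
      _ = sinh x := by
          field_simp
          linear_combination hsq
      _ ≤ 2 * x := by nlinarith
  have hprod0 : 0 ≤ (sinh x / x - 1) * L := mul_nonneg hr0 hL0
  rw [hF, abs_le]
  constructor <;> nlinarith

theorem abs_tsum_Sfun_sub_le {l : ℝ} (hl : 0 < l) :
    |(∑' n : ℕ, Sfun ((n + 1) * l)) - (2 / l - SfunPrimitive (l / 2) / l + 1 - log π)| ≤ l := by
  set h : ℝ → ℝ := fun t => Sfun t + 2 * log t with hh
  set H : ℝ → ℝ := fun t => SfunPrimitive t + 2 * (t * log t - t) with hH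
  set Q : ℝ → ℝ := fun t => 2 * cosh t / sinh t - 2 / t with hQ
  have hHd : ∀ t, 0 < t → HasDerivAt H (h t) t := by
    intro t ht
    have h1 := (((hasDerivAt_id t).mul (hasDerivAt_log ht.ne')).sub (hasDerivAt_id t)).const_mul 2
    refine ((hasDerivAt_SfunPrimitive ht).add h1).congr_deriv ?_
    simp only [hh, id]
    field_simp
    ring
  have hhd : ∀ t, 0 < t → HasDerivAt h (SfunPrimitive t - Q t) t := by
    intro t ht
    refine ((hasDerivAt_Sfun ht).add ((hasDerivAt_log ht.ne').const_mul 2)).congr_deriv ?_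
    simp only [hQ]
    ring
  set T : ℕ → ℝ := fun N => (N + 1 / 2) * l with hT
  have hTtop : Tendsto T atTop atTop :=
    (tendsto_atTop_add_const_right _ _ tendsto_natCast_atTop_atTop).atTop_mul_const hl
  set A : ℕ → ℝ := fun N => ∑ n ∈ Finset.range N, Sfun ((n + 1) * l) with hA
  set R : ℕ → ℝ := fun N => SfunPrimitive (T N) / l - SfunPrimitive (l / 2) / l +
    ((2 * N + 1 : ℝ) * log (N + 1 / 2) - 2 * N - 2 * log (N.factorial)) + log 2 with hR
  have hRlim : Tendsto R atTop (𝓝 (2 / l - SfunPrimitive (l / 2) / l + 1 - log π)) := by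
    have := ((((tendsto_SfunPrimitive_atTop.comp hTtop).div_const l).sub_const
      (SfunPrimitive (l / 2) / l)).add tendsto_stirling_half).add_const (log 2)
    have e : 2 / l - SfunPrimitive (l / 2) / l + (1 - log (2 * π)) + log 2 =
        2 / l - SfunPrimitive (l / 2) / l + 1 - log π := by
      rw [log_mul two_ne_zero pi_ne_zero]
      ring
    rwa [e] at this
  have hbound : ∀ N, |A N - R N| ≤ l / 4 * (SfunPrimitive (T N) + 2 * cosh (T N) / sinh (T N)) := by
    intro N
    have hTN : 0 < T N := by positivity
    have hl2 : 0 < l / 2 := by positivity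
    have hmid := abs_sum_midpoint_error_le hHd hhd monotoneOn_SfunPrimitive
      monotoneOn_coth_sub_inv hl N
    have e : H ((N + 1 / 2) * l) - H (l / 2) - l * ∑ n ∈ Finset.range N, h ((n + 1) * l) =
        -(l * (A N - R N)) := by
      simp only [hH, hh, hA, hR, hT]
      rw [Finset.sum_add_distrib, ← Finset.mul_sum, sum_log_succ_mul hl,
        log_mul (by positivity) hl.ne', log_div hl.ne' two_ne_zero]
      field_simp
      ring
    rw [e, abs_neg, abs_mul, abs_of_pos hl] at hmid
    have p0 := SfunPrimitive_nonneg hl2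
    have q0 : 0 ≤ Q (l / 2) := coth_sub_inv_nonneg hl2
    have hQT : Q (T N) ≤ 2 * cosh (T N) / sinh (T N) := by
      simp only [hQ]
      have : 0 ≤ 2 / T N := by positivity
      linarith
    have hle : SfunPrimitive (T N) - SfunPrimitive (l / 2) + (Q (T N) - Q (l / 2)) ≤
        SfunPrimitive (T N) + 2 * cosh (T N) / sinh (T N) := by linarith
    have := hmid.trans (mul_le_mul_of_nonneg_left hle (sq_nonneg (l / 2)))
    refine le_of_mul_le_mul_left (this.trans_eq ?_) hl
    ring
  have hElim : Tendsto (fun N => l / 4 * (SfunPrimitive (T N) + 2 * cosh (T N) / sinh (T N)))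
      atTop (𝓝 l) := by
    have := ((tendsto_SfunPrimitive_atTop.comp hTtop).add
      (tendsto_coth_atTop_two.comp hTtop)).const_mul (l / 4)
    rwa [show l / 4 * (2 + 2) = l by ring] at this
  have hnonneg : ∀ n : ℕ, 0 ≤ Sfun ((n + 1) * l) := fun n => Sfun_nonneg (by positivity)
  obtain ⟨c, hc⟩ := (hRlim.add hElim).bddAbove_range
  have hsummable : Summable fun n : ℕ => Sfun ((n + 1) * l) := by
    refine summable_of_sum_range_le (c := c) hnonneg fun N => ?_
    have h1 := (abs_le.1 (hbound N)).2
    have h2 := hc (mem_range_self N)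
    change A N ≤ c
    linarith
  exact le_of_tendsto_of_tendsto' (hsummable.hasSum.tendsto_sum_nat.sub hRlim).abs hElim hbound

/-- Circuit sum at `a = 1`: for `ε > 0`,
`∑_{n≥1} S(nℓ) = 2/ℓ + log(ℓ/(4π)) + 1 + O(ℓ^{1−ε})` as `ℓ → 0⁺`. -/
theorem circuit_sum_a_one_expansion (ε : ℝ) (hε : 0 < ε) :
    ∃ C δ : ℝ, 0 < δ ∧ ∀ ℓ : ℝ, 0 < ℓ → ℓ < δ →
      |(∑' n : ℕ, Sfun ((n + 1) * ℓ)) -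
          (2 / ℓ + Real.log (ℓ / (4 * Real.pi)) + 1)|
        ≤ C * ℓ ^ (1 - ε) := by
  refine ⟨3, 1, one_pos, fun ℓ hℓ hℓ1 => ?_⟩
  have h1 := abs_tsum_Sfun_sub_le hℓ
  have h2 := abs_SfunPrimitive_div_add_log_le (x := ℓ / 2) (by positivity) (by linarith)
  have e1 : 2 * (ℓ / 2) = ℓ := by ring
  have e2 : log (ℓ / (4 * π)) = log (ℓ / 2 / 2) - log π := by
    rw [← log_div (by positivity) pi_ne_zero]
    congr 1
    field_simp
    norm_num
  have hpow : ℓ ≤ ℓ ^ (1 - ε) := by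
    simpa using rpow_le_rpow_of_exponent_ge hℓ hℓ1.le (show 1 - ε ≤ 1 by linarith)
  rw [e1] at h2
  rw [e2]
  rw [abs_le] at *
  constructor <;> linarith [h1.1, h1.2, h2.1, h2.2]
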